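/- Suppose the space of positive angle structures A is nonempty. Then the point of the closure of A at which the volume functional 𝒱 attains its maximum is unique; that is, there exists exactly one α in the closure of A such that 𝒱(β) ≤ 𝒱(α) for all β in the closure of A. -/

import Mathlib

open Real

/-- The Lobachevsky function `Λ(x) = -∫₀ˣ log |2 sin t| dt`. -/
noncomputable def lob (x : ℝ) : ℝ := -∫ t in (0:ℝ)..x, Real.log |2 * Real.sin t|

/-- The space of positive angle structures for a triangulation with `n` tetrahedra and
edge-coefficient data `c : E → (Fin n × Fin 3) → ℕ`: every angle lies in `(0,π)`, the
three angles of each tetrahedron sum to `π`, and each edge equation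
`Σ c(e)(i,j)·θ(i,j) = 2π` holds. -/
def angleStructures (n : ℕ) {E : Type*} [Fintype E]
    (c : E → (Fin n × Fin 3) → ℕ) : Set (Fin n × Fin 3 → ℝ) :=
  {θ | (∀ x, θ x ∈ Set.Ioo 0 π) ∧
       (∀ i : Fin n, θ (i, 0) + θ (i, 1) + θ (i, 2) = π) ∧
       (∀ e : E, ∑ x : Fin n × Fin 3, (c e x : ℝ) * θ x = 2 * π)}

/-- The volume functional `𝒱(θ) = Σ Λ(θ(i,j))`. -/
noncomputable def volFun (n : ℕ) (θ : Fin n × Fin 3 → ℝ) : ℝ :=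
  ∑ x : Fin n × Fin 3, lob (θ x)

open Filter Topology MeasureTheory

lemma intervalIntegrable_log_abs_two_mul_sin (a b : ℝ) :
    IntervalIntegrable (fun t => Real.log |2 * Real.sin t|) volume a b := by
  have h : MeromorphicOn (fun t : ℝ => 2 * Real.sin t) (Set.uIcc a b) := by
    intro x _
    have : AnalyticAt ℝ (fun t : ℝ => 2 * Real.sin t) x :=
      analyticAt_const.mul Real.analyticAt_sin
    exact this.meromorphicAt
  simpa [Real.norm_eq_abs] using h.intervalIntegrable_log_norm

lemma continuous_lob : Continuous lob :=
  (intervalIntegral.continuous_primitive intervalIntegrable_log_abs_two_mul_sin 0).neg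

lemma lob_zero : lob 0 = 0 := by simp [lob]

lemma hasDerivAt_lob {x : ℝ} (hx : x ∈ Set.Ioo 0 π) :
    HasDerivAt lob (-Real.log (2 * Real.sin x)) x := by
  have hs : 0 < Real.sin x := Real.sin_pos_of_mem_Ioo hx
  have hm : Measurable (fun t : ℝ => Real.log |2 * Real.sin t|) := by fun_prop
  have hc : ContinuousAt (fun t : ℝ => Real.log |2 * Real.sin t|) x := by
    refine ContinuousAt.log (by fun_prop) ?_
    positivity
  have h := intervalIntegral.integral_hasDerivAt_right
    (intervalIntegrable_log_abs_two_mul_sin 0 x)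
    hm.stronglyMeasurable.stronglyMeasurableAtFilter hc
  rw [Real.log_abs] at h
  exact h.neg

lemma lob_pi : lob π = 0 := by
  have h : ∫ t in (0:ℝ)..π, Real.log |2 * Real.sin t| =
      ∫ t in (0:ℝ)..π, (Real.log 2 + Real.log (Real.sin t)) := by
    refine intervalIntegral.integral_congr_ae ?_
    have : ∀ᵐ t : ℝ, t ≠ π := by simp [ae_iff]
    filter_upwards [this] with t ht hmem
    rw [Set.uIoc_of_le Real.pi_pos.le] at hmem
    have hs : 0 < Real.sin t := Real.sin_pos_of_mem_Ioo ⟨hmem.1, lt_of_le_of_ne hmem.2 ht⟩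
    rw [Real.log_abs, Real.log_mul two_ne_zero hs.ne']
  have hi : IntervalIntegrable (fun t => Real.log (Real.sin t)) volume 0 π :=
    intervalIntegrable_log_sin
  rw [lob, h, intervalIntegral.integral_add intervalIntegrable_const hi,
    integral_log_sin_zero_pi]
  simp
  ring

lemma lob_pi_sub (x : ℝ) : lob (π - x) = -lob x := by
  have h1 := intervalIntegral.integral_add_adjacent_intervals
    (intervalIntegrable_log_abs_two_mul_sin 0 (π - x))
    (intervalIntegrable_log_abs_two_mul_sin (π - x) π)
  have h2 := intervalIntegral.integral_comp_sub_left
    (a := 0) (b := x) (fun t => Real.log |2 * Real.sin t|) π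
  simp only [Real.sin_pi_sub, sub_zero] at h2
  have h3 := lob_pi
  simp only [lob] at h3 ⊢
  linarith

/-- The slope of the Lobachevsky function at `0` is infinite. -/
lemma tendsto_lob_div_self : Tendsto (fun s => lob s / s) (𝓝[>] 0) atTop := by
  have hl : Tendsto (fun s : ℝ => -Real.log (2 * s)) (𝓝[>] 0) atTop := by
    refine tendsto_neg_atBot_atTop.comp (Real.tendsto_log_nhdsGT_zero.comp ?_)
    refine tendsto_nhdsWithin_iff.2 ⟨?_, ?_⟩
    · have : Continuous fun s : ℝ => 2 * s := by fun_prop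
      simpa using (this.tendsto 0).mono_left nhdsWithin_le_nhds
    · filter_upwards [self_mem_nhdsWithin] with s hs
      simpa using hs
  refine tendsto_atTop_mono' _ ?_ hl
  filter_upwards [Ioo_mem_nhdsGT Real.pi_pos] with s hs
  obtain ⟨ξ, hξ, h⟩ := exists_hasDerivAt_eq_slope lob (fun x => -Real.log (2 * Real.sin x)) hs.1
    continuous_lob.continuousOn
    (fun x hx => hasDerivAt_lob ⟨hx.1, hx.2.trans hs.2⟩)
  rw [lob_zero, sub_zero, sub_zero] at h
  rw [← h]
  have hpos := Real.sin_pos_of_mem_Ioo ⟨hξ.1, hξ.2.trans hs.2⟩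
  have hle := Real.sin_le hξ.1.le
  exact neg_le_neg (Real.log_le_log (by positivity) (by linarith [hξ.2]))

lemma tendsto_lob_sum_div {p b : ℝ} (hp : 0 < p) (hb : b ∈ Set.Ioo 0 π) (d : ℝ) :
    Tendsto (fun t => (lob (t * p) + lob (b + t * d) + lob (π - (b + t * (d + p)))) / t)
      (𝓝[>] 0) atTop := by
  have h1 : Tendsto (fun t => p * (lob (t * p) / (t * p))) (𝓝[>] 0) atTop := by
    refine Tendsto.const_mul_atTop hp (tendsto_lob_div_self.comp ?_)
    refine tendsto_nhdsWithin_iff.2 ⟨?_, ?_⟩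
    · have : Continuous fun s : ℝ => s * p := by fun_prop
      simpa using (this.tendsto 0).mono_left nhdsWithin_le_nhds
    · filter_upwards [self_mem_nhdsWithin] with s hs
      exact mul_pos hs hp
  have h2 : HasDerivAt (fun t => lob (b + t * d) - lob (b + t * (d + p)))
      (-Real.log (2 * Real.sin b) * d - -Real.log (2 * Real.sin b) * (d + p)) 0 := by
    have key (e : ℝ) : HasDerivAt (fun t => lob (b + t * e))
        (-Real.log (2 * Real.sin b) * e) 0 := by
      have hi : HasDerivAt (fun t : ℝ => b + t * e) e 0 := by
        simpa using ((hasDerivAt_id (0 : ℝ)).mul_const e).const_add b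
      refine HasDerivAt.comp (h₂ := lob) 0 ?_ hi
      simpa using hasDerivAt_lob hb
    exact (key d).sub (key (d + p))
  have h3 := h2.tendsto_slope_zero_right
  refine (h1.atTop_add h3).congr' ?_
  filter_upwards [self_mem_nhdsWithin] with t ht
  have ht : t ≠ 0 := ne_of_gt ht
  rw [lob_pi_sub]
  simp only [zero_add, zero_mul, add_zero, sub_self, sub_zero, smul_eq_mul]
  field_simp
  ring

/-- The closed triangle of (possibly degenerate) angles of an ideal tetrahedron. -/
def angleTriangle : Set (Fin 3 → ℝ) := {x | (∀ k, 0 ≤ x k) ∧ ∑ k, x k = π}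

/-- The volume of the ideal tetrahedron with dihedral angles `x`. -/
noncomputable def tetVol (x : Fin 3 → ℝ) : ℝ := ∑ k, lob (x k)

lemma convex_angleTriangle : Convex ℝ angleTriangle := by
  rintro x ⟨hx, hx'⟩ y ⟨hy, hy'⟩ a b ha hb hab
  refine ⟨fun k => ?_, ?_⟩
  · have := hx k
    have := hy k
    simp only [Pi.add_apply, Pi.smul_apply, smul_eq_mul]
    positivity
  · simp only [Pi.add_apply, Pi.smul_apply, smul_eq_mul, Finset.sum_add_distrib,
      ← Finset.mul_sum, hx', hy', ← add_mul, hab, one_mul]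

lemma isClosed_angleTriangle : IsClosed angleTriangle := by
  have h1 : IsClosed {x : Fin 3 → ℝ | ∀ k, 0 ≤ x k} := isClosed_Ici (a := (0 : Fin 3 → ℝ))
  have h2 : IsClosed {x : Fin 3 → ℝ | ∑ k, x k = π} := isClosed_eq (by fun_prop) continuous_const
  exact h1.inter h2

lemma tetVol_eq_zero {x : Fin 3 → ℝ} (hx : x ∈ angleTriangle) {k : Fin 3} (hk : x k = 0) :
    tetVol x = 0 := by
  have hs := hx.2
  rw [Fin.sum_univ_three] at hs
  rw [tetVol, Fin.sum_univ_three]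
  fin_cases k <;> simp only [Fin.zero_eta, Fin.mk_one, Fin.reduceFinMk] at hk <;>
    rw [hk] at hs ⊢
  · rw [show x 2 = π - x 1 by linarith, lob_pi_sub, lob_zero]; ring
  · rw [show x 2 = π - x 0 by linarith, lob_pi_sub, lob_zero]; ring
  · rw [show x 1 = π - x 0 by linarith, lob_pi_sub, lob_zero]; ring

lemma lt_pi_of_pos {x : Fin 3 → ℝ} (hx : x ∈ angleTriangle) (hpos : ∀ k, 0 < x k) (k : Fin 3) :
    x k < π := by
  have hs := hx.2
  rw [Fin.sum_univ_three] at hs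
  have h0 := hpos 0
  have h1 := hpos 1
  have h2 := hpos 2
  fin_cases k <;> simp <;> linarith

/-- The cotangents of the angles of a triangle form a definite quadratic form on the plane of
vectors of zero sum. -/
lemma sum_sq_mul_cot_pos {x u : Fin 3 → ℝ} (hx : x ∈ angleTriangle) (hpos : ∀ k, 0 < x k)
    (hu : ∑ k, u k = 0) (hu0 : u ≠ 0) :
    0 < ∑ k, u k ^ 2 * (Real.cos (x k) / Real.sin (x k)) := by
  have hs (k : Fin 3) : 0 < Real.sin (x k) :=
    Real.sin_pos_of_mem_Ioo ⟨hpos k, lt_pi_of_pos hx hpos k⟩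
  have hsum := hx.2
  rw [Fin.sum_univ_three] at hsum hu ⊢
  have h0 := hs 0
  have h1 := hs 1
  have h2 := hs 2
  have h2s : Real.sin (x 2) = Real.sin (x 0 + x 1) := by
    rw [show x 2 = π - (x 0 + x 1) by linarith, Real.sin_pi_sub]
  have h1s : Real.sin (x 1) = Real.sin (x 0 + x 2) := by
    rw [show x 1 = π - (x 0 + x 2) by linarith, Real.sin_pi_sub]
  have h2c : Real.cos (x 2) = -Real.cos (x 0 + x 1) := by
    rw [show x 2 = π - (x 0 + x 1) by linarith, Real.cos_pi_sub]
  set a := Real.cos (x 0) / Real.sin (x 0) with ha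
  set b := Real.cos (x 1) / Real.sin (x 1) with hb
  set c := Real.cos (x 2) / Real.sin (x 2) with hc
  have hac : 0 < a + c := by
    have : a + c = Real.sin (x 1) / (Real.sin (x 0) * Real.sin (x 2)) := by
      rw [h1s, Real.sin_add, ha, hc]
      field_simp
      ring
    rw [this]
    positivity
  have habc : a * b + b * c + c * a = 1 := by
    have : a * b - 1 + c * (a + b) = 0 := by
      have e1 : a * b - 1 = -Real.cos (x 2) / (Real.sin (x 0) * Real.sin (x 1)) := by
        rw [h2c, Real.cos_add, ha, hb]
        field_simp
      have e2 : a + b = Real.sin (x 2) / (Real.sin (x 0) * Real.sin (x 1)) := by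
        rw [h2s, Real.sin_add, ha, hb]
        field_simp
        ring
      rw [e1, e2, hc]
      field_simp
      ring
    linarith
  have hu2 : u 2 = -(u 0 + u 1) := by linarith
  have key : (a + c) * (u 0 ^ 2 * a + u 1 ^ 2 * b + u 2 ^ 2 * c) =
      ((a + c) * u 0 + c * u 1) ^ 2 + u 1 ^ 2 := by
    rw [hu2]
    linear_combination (u 1 ^ 2) * habc
  refine pos_of_mul_pos_right (a := a + c) ?_ hac.le
  rw [key]
  by_cases hu1 : u 1 = 0
  · have hu00 : u 0 ≠ 0 := by
      intro h
      refine hu0 (funext fun k => ?_)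
      fin_cases k <;> simp_all
    rw [hu1]
    have := hac.ne'
    simp
    positivity
  · positivity

lemma strictConcaveOn_tetVol_segment {x y : Fin 3 → ℝ} (hx : x ∈ angleTriangle)
    (hy : y ∈ angleTriangle) (hne : x ≠ y) (hpos : ∀ k, 0 < x k + y k) :
    StrictConcaveOn ℝ (Set.Icc 0 1) (fun t : ℝ => tetVol (x + t • (y - x))) := by
  have hmem : ∀ t ∈ Set.Ioo (0 : ℝ) 1,
      x + t • (y - x) ∈ angleTriangle ∧ ∀ k, 0 < (x + t • (y - x)) k := by
    intro t ht
    refine ⟨convex_angleTriangle.add_smul_sub_mem hx hy ⟨ht.1.le, ht.2.le⟩, fun k => ?_⟩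
    have h1 := hx.1 k
    have h2 := hy.1 k
    have h3 := hpos k
    have h4 : 0 < 1 - t := sub_pos.2 ht.2
    have h5 := ht.1
    have e : (x + t • (y - x)) k = (1 - t) * x k + t * y k := by
      simp only [Pi.add_apply, Pi.smul_apply, Pi.sub_apply, smul_eq_mul]; ring
    rw [e]
    rcases h1.eq_or_lt with h | h
    · rw [← h] at h3 ⊢
      have : 0 < y k := by linarith
      positivity
    · positivity
  have hu : ∑ k, (y - x) k = 0 := by
    simp [Finset.sum_sub_distrib, hx.2, hy.2]
  have hin (k : Fin 3) (t : ℝ) : HasDerivAt (fun t : ℝ => (x + t • (y - x)) k) ((y - x) k) t := by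
    simpa using ((hasDerivAt_id t).mul_const (y k - x k)).const_add (x k)
  have hd1 : ∀ t ∈ Set.Ioo (0 : ℝ) 1, HasDerivAt (fun t : ℝ => tetVol (x + t • (y - x)))
      (∑ k, -Real.log (2 * Real.sin ((x + t • (y - x)) k)) * (y - x) k) t := by
    intro t ht
    obtain ⟨hT, hp⟩ := hmem t ht
    unfold tetVol
    refine HasDerivAt.fun_sum fun k _ => ?_
    exact HasDerivAt.comp (h₂ := lob) t (hasDerivAt_lob ⟨hp k, lt_pi_of_pos hT hp k⟩) (hin k t)
  have hd2 : ∀ t ∈ Set.Ioo (0 : ℝ) 1, HasDerivAt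
      (fun t : ℝ => ∑ k, -Real.log (2 * Real.sin ((x + t • (y - x)) k)) * (y - x) k)
      (-∑ k, (y - x) k ^ 2 *
        (Real.cos ((x + t • (y - x)) k) / Real.sin ((x + t • (y - x)) k))) t := by
    intro t ht
    obtain ⟨hT, hp⟩ := hmem t ht
    rw [← Finset.sum_neg_distrib]
    refine HasDerivAt.fun_sum fun k _ => ?_
    have hs := Real.sin_pos_of_mem_Ioo ⟨hp k, lt_pi_of_pos hT hp k⟩
    have h := ((((hin k t).sin).const_mul 2).log (by positivity)).neg.mul_const ((y - x) k)
    refine h.congr_deriv ?_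
    field_simp
  refine StrictAntiOn.strictConcaveOn_of_deriv (convex_Icc 0 1) ?_ ?_
  · have : Continuous (fun t : ℝ => tetVol (x + t • (y - x))) := by
      unfold tetVol
      have := continuous_lob
      fun_prop
    exact this.continuousOn
  · rw [interior_Icc]
    refine StrictAntiOn.congr ?_ fun t ht => ((hd1 t ht).deriv).symm
    refine strictAntiOn_of_deriv_neg (convex_Ioo 0 1)
      (fun t ht => (hd2 t ht).continuousAt.continuousWithinAt) fun t ht => ?_
    rw [interior_Ioo] at ht
    obtain ⟨hT, hp⟩ := hmem t ht
    rw [(hd2 t ht).deriv, neg_lt_zero]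
    exact sum_sq_mul_cot_pos hT hp hu (sub_ne_zero.2 hne.symm)

lemma lt_tetVol_combination {x y : Fin 3 → ℝ} (hx : x ∈ angleTriangle) (hy : y ∈ angleTriangle)
    (hne : x ≠ y) (hpos : ∀ k, 0 < x k + y k) {a b : ℝ} (ha : 0 < a) (hb : 0 < b)
    (hab : a + b = 1) : a * tetVol x + b * tetVol y < tetVol (a • x + b • y) := by
  have h := (strictConcaveOn_tetVol_segment hx hy hne hpos).2 (x := 0) (y := 1)
    (by simp) (by simp) zero_ne_one ha hb hab
  have e : x + b • (y - x) = a • x + b • y := by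
    rw [← eq_sub_iff_add_eq] at hab
    subst hab
    module
  simpa [e] using h

lemma concaveOn_tetVol : ConcaveOn ℝ angleTriangle tetVol := by
  refine ⟨convex_angleTriangle, fun x hx y hy a b ha hb hab => ?_⟩
  rcases ha.eq_or_lt with rfl | ha'
  · simp_all
  rcases hb.eq_or_lt with rfl | hb'
  · simp_all
  by_cases hne : x = y
  · subst hne
    rw [← add_smul, ← add_smul, hab, one_smul, one_smul]
  by_cases hpos : ∀ k, 0 < x k + y k
  · exact (lt_tetVol_combination hx hy hne hpos ha' hb' hab).le
  · push Not at hpos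
    obtain ⟨k, hk⟩ := hpos
    have hxk : x k = 0 := by linarith [hx.1 k, hy.1 k]
    have hyk : y k = 0 := by linarith [hx.1 k, hy.1 k]
    rw [tetVol_eq_zero hx hxk, tetVol_eq_zero hy hyk,
      tetVol_eq_zero (convex_angleTriangle hx hy ha hb hab) (k := k) (by simp [hxk, hyk])]
    simp

/-- At a degenerate tetrahedron with exactly one vanishing angle, the volume has infinite slope
in every direction pointing to a nondegenerate tetrahedron. -/
lemma tendsto_tetVol_div {x p : Fin 3 → ℝ} (hx : x ∈ angleTriangle) (hp : p ∈ angleTriangle)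
    {k : Fin 3} (hk : x k = 0) (hpk : 0 < p k) (hpos : ∀ j ≠ k, 0 < x j) :
    Tendsto (fun t : ℝ => tetVol ((1 - t) • x + t • p) / t) (𝓝[>] 0) atTop := by
  have hxs := hx.2
  have hps := hp.2
  rw [Fin.sum_univ_three] at hxs hps
  have main (i j : Fin 3) (hj : 0 < x j) (hi : 0 < x i) (hxs : x k + x i + x j = π)
      (hps : p k + p i + p j = π)
      (hsum : ∀ f : Fin 3 → ℝ, ∑ l, f l = f k + f i + f j) :
      Tendsto (fun t : ℝ => tetVol ((1 - t) • x + t • p) / t) (𝓝[>] 0) atTop := by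
    refine (tendsto_lob_sum_div hpk (b := x i) ⟨hi, by linarith⟩ (p i - x i)).congr fun t => ?_
    rw [tetVol, hsum]
    simp only [Pi.add_apply, Pi.smul_apply, smul_eq_mul, hk]
    rw [show x j = π - x i by linarith, show p j = π - p k - p i by linarith]
    congr 4 <;> ring
  fin_cases k
  · exact main 1 2 (hpos 2 (by decide)) (hpos 1 (by decide)) (by simpa using hxs)
      (by simpa using hps) fun f => by simp [Fin.sum_univ_three]
  · exact main 0 2 (hpos 2 (by decide)) (hpos 0 (by decide)) (by simp; linarith)
      (by simp; linarith) fun f => by simp [Fin.sum_univ_three]; ring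
  · exact main 0 1 (hpos 1 (by decide)) (hpos 0 (by decide)) (by simp; linarith)
      (by simp; linarith) fun f => by simp [Fin.sum_univ_three]; ring

section AngleStructures

variable {n : ℕ} {E : Type*} [Fintype E] {c : E → (Fin n × Fin 3) → ℕ}

lemma volFun_eq_sum_tetVol (θ : Fin n × Fin 3 → ℝ) :
    volFun n θ = ∑ i, tetVol (fun k => θ (i, k)) := by
  simp only [volFun, tetVol, Fintype.sum_prod_type]

lemma continuous_volFun : Continuous (volFun n) := by
  unfold volFun
  have := continuous_lob
  fun_prop

lemma convex_angleStructures : Convex ℝ (angleStructures n c) := by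
  rintro x ⟨hx, hxs, hxe⟩ y ⟨hy, hys, hye⟩ a b ha hb hab
  refine ⟨fun k => convex_Ioo 0 π (hx k) (hy k) ha hb hab, fun i => ?_, fun e => ?_⟩
  · simp only [Pi.add_apply, Pi.smul_apply, smul_eq_mul]
    linear_combination a * hxs i + b * hys i + π * hab
  · simp only [Pi.add_apply, Pi.smul_apply, smul_eq_mul, mul_add, Finset.sum_add_distrib,
      mul_left_comm _ a, mul_left_comm _ b, ← Finset.mul_sum, hxe, hye]
    linear_combination 2 * π * hab

lemma isCompact_closure_angleStructures : IsCompact (closure (angleStructures n c)) := by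
  refine (isCompact_Icc (a := fun _ => (0 : ℝ)) (b := fun _ => π)).closure_of_subset ?_
  exact fun θ hθ => ⟨fun k => (hθ.1 k).1.le, fun k => (hθ.1 k).2.le⟩

lemma mem_angleTriangle_of_mem_closure {θ : Fin n × Fin 3 → ℝ}
    (hθ : θ ∈ closure (angleStructures n c)) (i : Fin n) :
    (fun k => θ (i, k)) ∈ angleTriangle := by
  have hcl : IsClosed {θ : Fin n × Fin 3 → ℝ | (fun k => θ (i, k)) ∈ angleTriangle} := by
    exact isClosed_angleTriangle.preimage (f := fun (θ : Fin n × Fin 3 → ℝ) k => θ (i, k))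
      (by fun_prop)
  refine closure_minimal (fun θ hθ => ?_) hcl hθ
  exact ⟨fun k => (hθ.1 _).1.le, by simpa [Fin.sum_univ_three] using hθ.2.1 i⟩

/-- A maximizer of the volume has no tetrahedron with exactly one vanishing angle. -/
lemma not_isMaxOn_volFun {m p : Fin n × Fin 3 → ℝ} (hm : m ∈ closure (angleStructures n c))
    (hp : p ∈ angleStructures n c) {i : Fin n} {k : Fin 3} (hk : m (i, k) = 0)
    (hpos : ∀ j ≠ k, 0 < m (i, j)) : ¬ IsMaxOn (volFun n) (closure (angleStructures n c)) m := by
  intro hmax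
  have hp' := subset_closure hp
  have hmT := mem_angleTriangle_of_mem_closure hm
  have hpT := mem_angleTriangle_of_mem_closure hp'
  set C : ℝ := ∑ j ∈ Finset.univ.erase i,
    (tetVol (fun k => m (j, k)) - tetVol (fun k => p (j, k))) with hC
  have hlim := tendsto_tetVol_div (hmT i) (hpT i) hk (hp.1 (i, k)).1 hpos
  obtain ⟨t, hgt, ht⟩ := ((hlim.eventually_gt_atTop C).and
    (Ioo_mem_nhdsGT (zero_lt_one' ℝ))).exists
  have ht1 : 0 ≤ 1 - t := sub_nonneg.2 ht.2.le
  have hle := hmax (convex_angleStructures.closure hm hp' ht1 ht.1.le (by ring))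
  rw [Set.mem_ofPred_eq, volFun_eq_sum_tetVol, volFun_eq_sum_tetVol,
    ← Finset.add_sum_erase _ _ (Finset.mem_univ i),
    ← Finset.add_sum_erase (a := i) _ (fun i => tetVol fun k => m (i, k)) (Finset.mem_univ i),
    tetVol_eq_zero (hmT i) hk] at hle
  have hrest : ∑ j ∈ Finset.univ.erase i, ((1 - t) * tetVol (fun k => m (j, k)) +
      t * tetVol (fun k => p (j, k))) ≤
      ∑ j ∈ Finset.univ.erase i, tetVol (fun k => ((1 - t) • m + t • p) (j, k)) :=
    Finset.sum_le_sum fun j _ => concaveOn_tetVol.2 (hmT j) (hpT j) ht1 ht.1.le (by ring)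
  rw [Finset.sum_add_distrib, ← Finset.mul_sum, ← Finset.mul_sum] at hrest
  rw [Finset.sum_sub_distrib] at hC
  rw [lt_div_iff₀ ht.1] at hgt
  have heq : tetVol (fun k => ((1 - t) • m + t • p) (i, k)) =
      tetVol ((1 - t) • (fun k => m (i, k)) + t • (fun k => p (i, k))) := rfl
  rw [heq] at hle
  rw [hC] at hgt
  linarith

lemma eq_of_isMaxOn_volFun {α β p : Fin n × Fin 3 → ℝ}
    (hα : α ∈ closure (angleStructures n c)) (hβ : β ∈ closure (angleStructures n c))
    (hp : p ∈ angleStructures n c)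
    (hαmax : IsMaxOn (volFun n) (closure (angleStructures n c)) α)
    (hβmax : IsMaxOn (volFun n) (closure (angleStructures n c)) β) : α = β := by
  by_contra hne
  have hαT := mem_angleTriangle_of_mem_closure hα
  have hβT := mem_angleTriangle_of_mem_closure hβ
  have hhalf : (0 : ℝ) < 1 / 2 := by norm_num
  have hval : volFun n α = volFun n β := le_antisymm (hβmax hα) (hαmax hβ)
  set m := (1 / 2 : ℝ) • α + (1 / 2 : ℝ) • β with hmdef
  have hm : m ∈ closure (angleStructures n c) :=
    convex_angleStructures.closure hα hβ hhalf.le hhalf.le (by norm_num)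
  have hle : ∀ i, 1 / 2 * tetVol (fun k => α (i, k)) + 1 / 2 * tetVol (fun k => β (i, k)) ≤
      tetVol (fun k => m (i, k)) := fun i =>
    concaveOn_tetVol.2 (hαT i) (hβT i) hhalf.le hhalf.le (by norm_num)
  have hsum : ∑ i, (1 / 2 * tetVol (fun k => α (i, k)) + 1 / 2 * tetVol (fun k => β (i, k))) =
      volFun n α := by
    rw [Finset.sum_add_distrib, ← Finset.mul_sum, ← Finset.mul_sum, ← volFun_eq_sum_tetVol,
      ← volFun_eq_sum_tetVol, ← hval]
    ring
  have hmax : IsMaxOn (volFun n) (closure (angleStructures n c)) m := by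
    intro γ hγ
    refine le_trans (isMaxOn_iff.1 hαmax γ hγ) ?_
    rw [← hsum, volFun_eq_sum_tetVol]
    exact Finset.sum_le_sum fun i _ => hle i
  obtain ⟨i, hi⟩ : ∃ i, (fun k => α (i, k)) ≠ fun k => β (i, k) := by
    by_contra! h
    exact hne (funext fun q => congrFun (h q.1) q.2)
  by_cases hpos : ∀ k, 0 < α (i, k) + β (i, k)
  · have hlt : volFun n α < volFun n m := by
      rw [← hsum, volFun_eq_sum_tetVol]
      exact Finset.sum_lt_sum (fun i _ => hle i) ⟨i, Finset.mem_univ i,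
        lt_tetVol_combination (hαT i) (hβT i) hi hpos hhalf hhalf (by norm_num)⟩
    exact (hαmax hm).not_gt hlt
  · push Not at hpos
    obtain ⟨k, hk⟩ := hpos
    have hαk : α (i, k) = 0 := le_antisymm (by linarith [(hβT i).1 k]) ((hαT i).1 k)
    have hβk : β (i, k) = 0 := le_antisymm (by linarith [(hαT i).1 k]) ((hβT i).1 k)
    refine not_isMaxOn_volFun hm hp (i := i) (k := k) (by simp [hmdef, hαk, hβk])
      (fun j hj => ?_) hmax
    by_contra hmj
    have hmj' : α (i, j) + β (i, j) ≤ 0 := by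
      simp only [hmdef, Pi.add_apply, Pi.smul_apply, smul_eq_mul] at hmj
      linarith
    have hαj : α (i, j) = 0 := le_antisymm (by linarith [(hβT i).1 j]) ((hαT i).1 j)
    have hβj : β (i, j) = 0 := le_antisymm (by linarith [(hαT i).1 j]) ((hβT i).1 j)
    have h1 := (hαT i).2
    have h2 := (hβT i).2
    rw [Fin.sum_univ_three] at h1 h2
    refine hi (funext fun l => ?_)
    fin_cases j <;> fin_cases k <;> fin_cases l <;> simp_all

end AngleStructures

/-- If the space of positive angle structures is nonempty, then the maximizer of the
volume functional over its closure is unique. -/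
theorem unique_volume_maximizer (n : ℕ) (hn : 1 ≤ n) (E : Type*) [Fintype E]
    (c : E → (Fin n × Fin 3) → ℕ)
    (hne : (angleStructures n c).Nonempty) :
    ∃! α : Fin n × Fin 3 → ℝ, α ∈ closure (angleStructures n c) ∧
      ∀ β ∈ closure (angleStructures n c), volFun n β ≤ volFun n α := by
  obtain ⟨p, hp⟩ := hne
  obtain ⟨α, hα, hmax⟩ := (isCompact_closure_angleStructures (c := c)).exists_isMaxOn
    ⟨p, subset_closure hp⟩ continuous_volFun.continuousOn
  exact ⟨α, ⟨hα, hmax⟩, fun β hβ => eq_of_isMaxOn_volFun hβ.1 hα hp hβ.2 hmax⟩
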